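/- There is an absolute constant C such that for every j ∈ Z^2, the sum over all quintuples (p1,p2,p3,p4,p5) ∈ (Z^2)^5 satisfying p1 - p2 + p3 - p4 + p5 = j and |p1|^2 - |p2|^2 + |p3|^2 - |p4|^2 + |p5|^2 = |j|^2 of the product (1+|p1|^2)^(-1)(1+|p2|^2)^(-1)(1+|p3|^2)^(-1)(1+|p4|^2)^(-1)(1+|p5|^2)^(-1) is at most C·(1+|j|^2)^(-1). -/

import Mathlib

/-- Quintuples of points of `ℤ²`. -/
abbrev Quint : Type := (ℤ × ℤ) × (ℤ × ℤ) × (ℤ × ℤ) × (ℤ × ℤ) × (ℤ × ℤ)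

/-- Squared Euclidean norm on `ℤ²`. -/
def nsqZ (p : ℤ × ℤ) : ℤ := p.1 ^ 2 + p.2 ^ 2

/-- The resonance conditions defining the set `𝓡(j)`. -/
def isRes (j : ℤ × ℤ) (v : Quint) : Prop :=
  v.1 - v.2.1 + v.2.2.1 - v.2.2.2.1 + v.2.2.2.2 = j ∧
  nsqZ v.1 - nsqZ v.2.1 + nsqZ v.2.2.1 - nsqZ v.2.2.2.1 + nsqZ v.2.2.2.2 = nsqZ j


noncomputable section Helpers

open scoped ENNReal BigOperators Classical

def hW (x : ℤ) : ℝ≥0∞ := ENNReal.ofReal ((1 + (x : ℝ) ^ 2) ^ (-(1 / 14) : ℝ))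

def gW (p : ℤ × ℤ) : ℝ≥0∞ := ENNReal.ofReal ((1 + (nsqZ p : ℝ)) ^ (-(1 / 14) : ℝ))

lemma nsqZ_nonneg (p : ℤ × ℤ) : 0 ≤ nsqZ p := by unfold nsqZ; positivity

lemma gW_anti {p q : ℤ × ℤ} (hpq : nsqZ p ≤ nsqZ q) : gW q ≤ gW p := by
  unfold gW
  apply ENNReal.ofReal_le_ofReal
  have h0 : (0 : ℝ) ≤ nsqZ p := by exact_mod_cast nsqZ_nonneg p
  have h1 : (nsqZ p : ℝ) ≤ nsqZ q := by exact_mod_cast hpq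
  apply Real.rpow_le_rpow_of_nonpos (by linarith) (by linarith) (by norm_num)

lemma gW_le_one (p : ℤ × ℤ) : gW p ≤ 1 := by
  have : gW p ≤ gW 0 := gW_anti (by simpa [nsqZ] using nsqZ_nonneg p)
  refine this.trans ?_
  simp [gW, nsqZ]

lemma gW_le_fst (x y : ℤ) : gW (x, y) ≤ hW x := by
  have : gW (x, y) ≤ gW (x, 0) := gW_anti (by simp [nsqZ]; positivity)
  simpa [gW, hW, nsqZ] using this

lemma gW_le_snd (x y : ℤ) : gW (x, y) ≤ hW y := by
  have : gW (x, y) ≤ gW (0, y) := gW_anti (by simp [nsqZ]; positivity)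
  simpa [gW, hW, nsqZ] using this

lemma gW_pow (p : ℤ × ℤ) : gW p ^ 14 = ENNReal.ofReal ((1 + (nsqZ p : ℝ))⁻¹) := by
  have h0 : (0 : ℝ) ≤ nsqZ p := by exact_mod_cast nsqZ_nonneg p
  unfold gW
  rw [← ENNReal.ofReal_pow (by positivity), ← Real.rpow_natCast, ← Real.rpow_mul (by positivity),
    ← Real.rpow_neg_one]
  norm_num

lemma hW_sum : ∑' x : ℤ, hW x ^ 8 ≠ ⊤ := by
  have key : ∀ x : ℤ, hW x ^ 8 = ENNReal.ofReal ((1 + (x : ℝ) ^ 2) ^ (-(4 / 7) : ℝ)) := by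
    intro x
    unfold hW
    rw [← ENNReal.ofReal_pow (by positivity), ← Real.rpow_natCast,
      ← Real.rpow_mul (by positivity)]
    norm_num
  have hs : Summable (fun x : ℤ => (1 + (x : ℝ) ^ 2) ^ (-(4 / 7) : ℝ)) := by
    have h1 : Summable (fun x : ℤ => |(x : ℝ)| ^ (-(8 / 7) : ℝ)) :=
      Real.summable_abs_int_rpow (by norm_num)
    refine Summable.of_norm_bounded_eventually h1 ?_
    refine (Set.finite_singleton (0 : ℤ)).subset ?_
    intro x hx
    by_contra hne
    apply hx
    simp only [Set.mem_singleton_iff] at hne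
    have hx0 : 0 < |(x : ℝ)| := abs_pos.mpr (by exact_mod_cast hne)
    show ‖(1 + (x : ℝ) ^ 2) ^ (-(4 / 7) : ℝ)‖ ≤ |(x : ℝ)| ^ (-(8 / 7) : ℝ)
    rw [Real.norm_of_nonneg (by positivity)]
    have e : |(x : ℝ)| ^ (-(8 / 7) : ℝ) = ((x : ℝ) ^ 2) ^ (-(4 / 7) : ℝ) := by
      rw [← sq_abs, ← Real.rpow_natCast, ← Real.rpow_mul hx0.le]
      norm_num
    rw [e]
    apply Real.rpow_le_rpow_of_nonpos (by rw [← sq_abs]; positivity) (by linarith) (by norm_num)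
  simp_rw [key]
  exact hs.tsum_ofReal_ne_top

lemma gW_sum : ∑' p : ℤ × ℤ, gW p ^ 16 ≠ ⊤ := by
  have : ∑' p : ℤ × ℤ, gW p ^ 16 ≤ (∑' x : ℤ, hW x ^ 8) * ∑' x : ℤ, hW x ^ 8 := by
    rw [ENNReal.tsum_prod', ← ENNReal.tsum_mul_right]
    refine ENNReal.tsum_le_tsum fun x => ?_
    rw [← ENNReal.tsum_mul_left]
    refine ENNReal.tsum_le_tsum fun y => ?_
    rw [show (16 : ℕ) = 8 + 8 from rfl, pow_add]
    gcongr
    · exact gW_le_fst x y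
    · exact gW_le_snd x y
  exact ne_top_of_le_ne_top (ENNReal.mul_ne_top hW_sum hW_sum) this

lemma two_sum {α : Type*} (P : α → Prop) (u v : α) (hP : ∀ y, P y → y = u ∨ y = v)
    (f : α → ℝ≥0∞) (M : ℝ≥0∞) (hf : ∀ y, f y ≤ M) :
    ∑' y, (if P y then f y else 0) ≤ 2 * M := by
  calc ∑' y, (if P y then f y else 0)
      ≤ ∑' y, ((if y = u then M else 0) + (if y = v then M else 0)) := by
        refine ENNReal.tsum_le_tsum fun y => ?_
        by_cases h : P y
        · rw [if_pos h]
          rcases hP y h with h | h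
          · rw [if_pos h]; exact (hf y).trans le_self_add
          · rw [if_pos h]; exact (hf y).trans le_add_self
        · rw [if_neg h]; exact zero_le
    _ = 2 * M := by
        rw [ENNReal.tsum_add, tsum_ite_eq, tsum_ite_eq, two_mul]

lemma one_sum {α : Type*} (P : α → Prop) (u : α) (hP : ∀ y, P y → y = u) (M : ℝ≥0∞) :
    ∑' y, (if P y then M else 0) ≤ if ∃ y, P y then M else 0 := by
  by_cases hex : ∃ y, P y
  · rw [if_pos hex]
    calc ∑' y, (if P y then M else 0) ≤ ∑' y, (if y = u then M else 0) := by
          refine ENNReal.tsum_le_tsum fun y => ?_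
          by_cases h : P y
          · rw [if_pos h, if_pos (hP y h)]
          · rw [if_neg h]; exact zero_le
      _ = M := by rw [tsum_ite_eq]
  · rw [if_neg hex]
    push Not at hex
    simp [hex]

def curve (s t : ℤ) (c : ℤ × ℤ) (e : ℤ) (a b : ℤ × ℤ) : Prop :=
  s • a + t • b = c ∧ s * nsqZ a + t * nsqZ b = e ∧ ¬ (a = b ∧ s = -t)

/-- the set of admissible `b` meets every vertical line (or every horizontal line)
in at most two points -/
lemma curve_two (s t : ℤ) (hs : s = 1 ∨ s = -1) (ht : t = 1 ∨ t = -1) (c : ℤ × ℤ) (e : ℤ) :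
    (∀ x, ∃ u v, ∀ y, (∃ a, curve s t c e a (x, y)) → y = u ∨ y = v) ∨
    (∀ y, ∃ u v, ∀ x, (∃ a, curve s t c e a (x, y)) → x = u ∨ x = v) := by
  obtain ⟨c1, c2⟩ := c
  by_cases hst : s = t
  · left
    intro x
    by_cases hex : ∃ y0, ∃ a, curve s t (c1, c2) e a (x, y0)
    · obtain ⟨y0, ⟨a1, a2⟩, ha⟩ := hex
      refine ⟨y0, s * c2 - y0, ?_⟩
      rintro y ⟨⟨b1, b2⟩, hb⟩
      subst hst
      simp only [curve, nsqZ, Prod.smul_mk, Prod.mk_add_mk, Prod.mk.injEq, smul_eq_mul] at ha hb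
      obtain ⟨⟨h1, h2⟩, h3, -⟩ := ha
      obtain ⟨⟨k1, k2⟩, k3, -⟩ := hb
      have : (y - y0) * (y - (s * c2 - y0)) = 0 := by
        rcases hs with rfl | rfl
        · have e1 : a1 = b1 := by linarith
          have e2 : a2 = c2 - y0 := by linarith
          have e3 : b2 = c2 - y := by linarith
          subst e1 e2 e3
          linarith
        · have e1 : a1 = b1 := by linarith
          have e2 : a2 = -c2 - y0 := by linarith
          have e3 : b2 = -c2 - y := by linarith
          subst e1 e2 e3
          linarith
      rcases mul_eq_zero.mp this with h | h
      · left; linarith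
      · right; linarith
    · refine ⟨0, 0, fun y hy => ?_⟩
      exact absurd ⟨y, hy⟩ hex
  · have hst' : t = -s := by omega
    subst hst'
    by_cases hc : c2 = 0
    · right
      intro y
      by_cases hex : ∃ x0, ∃ a, curve s (-s) (c1, c2) e a (x0, y)
      · obtain ⟨x0, ⟨a1, a2⟩, ha⟩ := hex
        refine ⟨x0, x0, ?_⟩
        rintro x ⟨⟨b1, b2⟩, hb⟩
        simp only [curve, nsqZ, Prod.smul_mk, Prod.mk_add_mk, Prod.mk.injEq, smul_eq_mul] at ha hb
        obtain ⟨⟨h1, h2⟩, h3, h4⟩ := ha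
        obtain ⟨⟨k1, k2⟩, k3, -⟩ := hb
        left
        have hc1 : c1 ≠ 0 := by
          intro h0
          apply h4
          subst h0 hc
          rcases hs with rfl | rfl <;> refine ⟨⟨?_, ?_⟩, ?_⟩ <;> linarith
        have : c1 * (x - x0) = 0 := by
          rcases hs with rfl | rfl
          · have e1 : a1 = c1 + x0 := by linarith
            have e2 : b1 = c1 + x := by linarith
            have e3 : a2 = b2 := by linarith
            subst e1 e2 e3
            linarith
          · have e1 : a1 = x0 - c1 := by linarith
            have e2 : b1 = x - c1 := by linarith
            have e3 : a2 = b2 := by linarith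
            subst e1 e2 e3
            linarith
        rcases mul_eq_zero.mp this with h | h
        · exact absurd h hc1
        · linarith
      · refine ⟨0, 0, fun y hy => ?_⟩
        exact absurd ⟨y, hy⟩ hex
    · left
      intro x
      by_cases hex : ∃ y0, ∃ a, curve s (-s) (c1, c2) e a (x, y0)
      · obtain ⟨y0, ⟨a1, a2⟩, ha⟩ := hex
        refine ⟨y0, y0, ?_⟩
        rintro y ⟨⟨b1, b2⟩, hb⟩
        simp only [curve, nsqZ, Prod.smul_mk, Prod.mk_add_mk, Prod.mk.injEq, smul_eq_mul] at ha hb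
        obtain ⟨⟨h1, h2⟩, h3, -⟩ := ha
        obtain ⟨⟨k1, k2⟩, k3, -⟩ := hb
        left
        have : c2 * (y - y0) = 0 := by
          rcases hs with rfl | rfl
          · have e1 : a2 = c2 + y0 := by linarith
            have e2 : b2 = c2 + y := by linarith
            have e3 : a1 = b1 := by linarith
            subst e1 e2 e3
            linarith
          · have e1 : a2 = y0 - c2 := by linarith
            have e2 : b2 = y - c2 := by linarith
            have e3 : a1 = b1 := by linarith
            subst e1 e2 e3
            linarith
        rcases mul_eq_zero.mp this with h | h
        · exact absurd h hc
        · linarith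
      · refine ⟨0, 0, fun y hy => ?_⟩
        exact absurd ⟨y, hy⟩ hex

lemma curve_sum (s t : ℤ) (hs : s = 1 ∨ s = -1) (ht : t = 1 ∨ t = -1) (c : ℤ × ℤ) (e : ℤ) :
    ∑' a, ∑' b, (if curve s t c e a b then gW b ^ 8 else 0) ≤ 2 * ∑' x : ℤ, hW x ^ 8 := by
  rw [ENNReal.tsum_comm]
  have h1 : ∑' b, ∑' a, (if curve s t c e a b then gW b ^ 8 else 0) ≤
      ∑' b, (if ∃ a, curve s t c e a b then gW b ^ 8 else 0) := by
    refine ENNReal.tsum_le_tsum fun b => ?_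
    refine one_sum _ (s • (c - t • b)) ?_ _
    rintro a ⟨h, -⟩
    rw [← h, add_sub_cancel_right, smul_smul]
    rcases hs with rfl | rfl <;> simp
  refine h1.trans ?_
  rw [ENNReal.tsum_prod']
  rcases curve_two s t hs ht c e with h | h
  · rw [← ENNReal.tsum_mul_left]
    refine ENNReal.tsum_le_tsum fun x => ?_
    obtain ⟨u, v, huv⟩ := h x
    refine two_sum _ u v huv _ _ fun y => ?_
    gcongr
    exact gW_le_fst x y
  · rw [ENNReal.tsum_comm, ← ENNReal.tsum_mul_left]
    refine ENNReal.tsum_le_tsum fun y => ?_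
    obtain ⟨u, v, huv⟩ := h y
    refine two_sum _ u v huv (fun x => gW (x, y) ^ 8) _ fun x => ?_
    gcongr
    exact gW_le_snd x y

lemma tsum_cons {n : ℕ} (F : (Fin (n + 1) → ℤ × ℤ) → ℝ≥0∞) :
    ∑' q, F q = ∑' a, ∑' r : Fin n → ℤ × ℤ, F (Fin.cons a r) := by
  rw [← (Fin.consEquiv (fun _ : Fin (n + 1) => ℤ × ℤ)).tsum_eq, ENNReal.tsum_prod']
  rfl

lemma tsum_pi (f : ℤ × ℤ → ℝ≥0∞) (n : ℕ) :
    ∑' r : Fin n → ℤ × ℤ, ∏ i, f (r i) = (∑' a, f a) ^ n := by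
  induction n with
  | zero => simp
  | succ n ih =>
    rw [tsum_cons]
    simp only [Fin.prod_univ_succ, Fin.cons_zero, Fin.cons_succ]
    simp_rw [ENNReal.tsum_mul_left, ih, ENNReal.tsum_mul_right]
    rw [pow_succ']

def EqR {n : ℕ} (σ : Fin n → ℤ) (j : ℤ × ℤ) (p : Fin n → ℤ × ℤ) : Prop :=
  ∑ i, σ i • p i = j ∧ ∑ i, σ i * nsqZ (p i) = nsqZ j

def Bd (n : ℕ) : Prop :=
  ∃ K : ℝ≥0∞, K ≠ ⊤ ∧ ∀ σ : Fin n → ℤ, (∀ i, σ i = 1 ∨ σ i = -1) → ∀ j : ℤ × ℤ,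
    ∑' p : Fin n → ℤ × ℤ, (if EqR σ j p then ∏ i, gW (p i) ^ 14 else 0) ≤ K * gW j ^ 14

lemma Bd_one : Bd 1 := by
  refine ⟨1, by simp, fun σ hσ j => ?_⟩
  rw [one_mul]
  have : ∀ p : Fin 1 → ℤ × ℤ, (if EqR σ j p then ∏ i, gW (p i) ^ 14 else 0) ≤
      if EqR σ j p then gW j ^ 14 else 0 := by
    intro p
    split_ifs with h
    · obtain ⟨h1, -⟩ := h
      simp only [Fin.sum_univ_one, Fin.prod_univ_one] at h1 ⊢
      gcongr
      apply gW_anti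
      rw [← h1]
      rcases hσ 0 with h | h <;> simp [h, nsqZ]
    · exact le_rfl
  refine (ENNReal.tsum_le_tsum this).trans ?_
  refine (one_sum _ (fun _ => σ 0 • j) ?_ _).trans ?_
  · rintro p ⟨h1, -⟩
    funext i
    obtain rfl : i = 0 := Subsingleton.elim _ _
    rw [← h1, Fin.sum_univ_one, smul_smul]
    rcases hσ 0 with h | h <;> simp [h]
  · split_ifs <;> simp

lemma nsq_sum_le {n : ℕ} (σ : Fin n → ℤ) (hσ : ∀ i, σ i = 1 ∨ σ i = -1) (q : Fin n → ℤ × ℤ)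
    (M : ℤ) (hM : ∀ i, nsqZ (q i) ≤ M) : nsqZ (∑ i, σ i • q i) ≤ n ^ 2 * M := by
  have h2 : ∀ i, σ i ^ 2 = 1 := fun i => by rcases hσ i with h | h <;> simp [h]
  have a1 := sq_sum_le_card_mul_sum_sq (s := Finset.univ) (f := fun i => σ i * (q i).1)
  have a2 := sq_sum_le_card_mul_sum_sq (s := Finset.univ) (f := fun i => σ i * (q i).2)
  simp only [mul_pow, h2, one_mul, Finset.card_univ, Fintype.card_fin] at a1 a2
  have a3 : ∑ i, nsqZ (q i) ≤ n * M := by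
    calc ∑ i, nsqZ (q i) ≤ ∑ i : Fin n, M := Finset.sum_le_sum fun i _ => hM i
      _ = n * M := by simp
  simp only [nsqZ, Finset.sum_add_distrib] at a3
  simp only [nsqZ, Prod.fst_sum, Prod.snd_sum, Prod.smul_fst, Prod.smul_snd, smul_eq_mul]
  nlinarith [a1, a2, a3, mul_le_mul_of_nonneg_left a3 (Int.natCast_nonneg n)]

lemma gW_max {n : ℕ} (σ : Fin (n + 1) → ℤ) (hσ : ∀ i, σ i = 1 ∨ σ i = -1)
    (q : Fin (n + 1) → ℤ × ℤ) (hM : ∀ i, nsqZ (q i) ≤ nsqZ (q 0)) (j : ℤ × ℤ)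
    (hj : ∑ i, σ i • q i = j) :
    gW (q 0) ^ 14 ≤ ENNReal.ofReal (((n : ℝ) + 1) ^ 2) * gW j ^ 14 := by
  have h := nsq_sum_le σ hσ q _ hM
  rw [hj] at h
  have h' : (nsqZ j : ℝ) ≤ ((n : ℝ) + 1) ^ 2 * nsqZ (q 0) := by exact_mod_cast h
  have h0 : (0 : ℝ) ≤ nsqZ (q 0) := by exact_mod_cast nsqZ_nonneg _
  have h1 : (0 : ℝ) ≤ nsqZ j := by exact_mod_cast nsqZ_nonneg _
  rw [gW_pow, gW_pow, ← ENNReal.ofReal_mul (by positivity)]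
  apply ENNReal.ofReal_le_ofReal
  rw [← div_eq_mul_inv, ← one_div, div_le_div_iff₀ (by positivity) (by positivity)]
  have : (1 : ℝ) ≤ ((n : ℝ) + 1) ^ 2 := by
    have : (0 : ℝ) ≤ n := by positivity
    nlinarith
  nlinarith

lemma EqR_cons {m : ℕ} (σ : Fin (m + 2) → ℤ) (j a b : ℤ × ℤ) (r : Fin m → ℤ × ℤ) :
    EqR σ j (Fin.cons a (Fin.cons b r)) ↔
      σ 0 • a + σ 1 • b = j - ∑ i : Fin m, σ i.succ.succ • r i ∧
      σ 0 * nsqZ a + σ 1 * nsqZ b = nsqZ j - ∑ i : Fin m, σ i.succ.succ * nsqZ (r i) := by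
  simp only [EqR, Fin.sum_univ_succ, Fin.cons_zero, Fin.cons_succ, Fin.succ_zero_eq_one]
  rw [eq_sub_iff_add_eq, eq_sub_iff_add_eq]
  simp only [add_assoc]

lemma tsum_cons2 {m : ℕ} (F : (Fin (m + 2) → ℤ × ℤ) → ℝ≥0∞) :
    ∑' q, F q = ∑' r : Fin m → ℤ × ℤ, ∑' a, ∑' b, F (Fin.cons a (Fin.cons b r)) := by
  rw [tsum_cons]
  simp_rw [tsum_cons (n := m)]
  rw [ENNReal.tsum_comm (α := Fin m → ℤ × ℤ)]
  refine tsum_congr fun a => ?_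
  rw [ENNReal.tsum_comm]

/-- the pointwise bound for ordered tuples -/
lemma sorted_point {m : ℕ} (hm : m ≤ 3) (σ : Fin (m + 2) → ℤ) (hσ : ∀ i, σ i = 1 ∨ σ i = -1)
    (j a b : ℤ × ℤ) (r : Fin m → ℤ × ℤ) (hE : EqR σ j (Fin.cons a (Fin.cons b r)))
    (hab : nsqZ b ≤ nsqZ a) (hbr : ∀ i, nsqZ (r i) ≤ nsqZ b) :
    gW a ^ 14 * (gW b ^ 14 * ∏ i, gW (r i) ^ 14) ≤
      (ENNReal.ofReal (((m + 1 : ℕ) + 1 : ℝ) ^ 2) * gW j ^ 14) *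
        (gW b ^ 8 * ∏ i, gW (r i) ^ 16) := by
  have h1 := gW_max σ hσ (Fin.cons a (Fin.cons b r)) (by
    intro i
    refine Fin.cases ?_ (fun i => ?_) i
    · exact le_rfl
    · refine Fin.cases ?_ (fun i => ?_) i
      · simpa using hab
      · simpa using (hbr i).trans hab) j hE.1
  rw [Fin.cons_zero] at h1
  refine mul_le_mul' h1 ?_
  have h2 : gW b ^ 6 ≤ ∏ i, gW (r i) ^ 2 := by
    calc gW b ^ 6 ≤ gW b ^ (2 * m) := pow_le_pow_right_of_le_one' (gW_le_one b) (by omega)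
      _ = ∏ i : Fin m, gW b ^ 2 := by simp [pow_mul]
      _ ≤ ∏ i, gW (r i) ^ 2 := by
        refine Finset.prod_le_prod' fun i _ => ?_
        gcongr
        exact gW_anti (hbr i)
  calc gW b ^ 14 * ∏ i, gW (r i) ^ 14 = gW b ^ 8 * (gW b ^ 6 * ∏ i, gW (r i) ^ 14) := by ring
    _ ≤ gW b ^ 8 * ((∏ i, gW (r i) ^ 2) * ∏ i, gW (r i) ^ 14) := by gcongr
    _ = gW b ^ 8 * ∏ i, gW (r i) ^ 16 := by
      rw [← Finset.prod_mul_distrib]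
      congr 1
      refine Finset.prod_congr rfl fun i _ => ?_
      ring

lemma sorted_sum {m : ℕ} (hm : m ≤ 3) (hB : Bd m) :
    ∃ K : ℝ≥0∞, K ≠ ⊤ ∧ ∀ σ : Fin (m + 2) → ℤ, (∀ i, σ i = 1 ∨ σ i = -1) → ∀ j : ℤ × ℤ,
      ∑' q : Fin (m + 2) → ℤ × ℤ,
        (if EqR σ j q ∧ (∀ i k, i ≤ k → nsqZ (q k) ≤ nsqZ (q i)) then ∏ i, gW (q i) ^ 14 else 0)
          ≤ K * gW j ^ 14 := by
  obtain ⟨K, hK, hKb⟩ := hB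
  set H := ∑' x : ℤ, hW x ^ 8 with hH
  set G := ∑' p : ℤ × ℤ, gW p ^ 16 with hG
  set A := ENNReal.ofReal (((m + 1 : ℕ) + 1 : ℝ) ^ 2) with hA
  refine ⟨A * ((2 * H) * G ^ m) + G * K, ?_, ?_⟩
  · refine ENNReal.add_ne_top.mpr ⟨?_, ENNReal.mul_ne_top gW_sum hK⟩
    exact ENNReal.mul_ne_top ENNReal.ofReal_ne_top (ENNReal.mul_ne_top
      (ENNReal.mul_ne_top (by simp) hW_sum) (ENNReal.pow_ne_top gW_sum))
  intro σ hσ j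
  rw [tsum_cons2]
  set c : (Fin m → ℤ × ℤ) → ℤ × ℤ := fun r => j - ∑ i : Fin m, σ i.succ.succ • r i with hc
  set e : (Fin m → ℤ × ℤ) → ℤ := fun r =>
    nsqZ j - ∑ i : Fin m, σ i.succ.succ * nsqZ (r i) with he
  set τ : Fin m → ℤ := fun i => σ i.succ.succ with hτ
  have hpt : ∀ (r : Fin m → ℤ × ℤ) (a b : ℤ × ℤ),
      (if EqR σ j (Fin.cons a (Fin.cons b r) : Fin (m + 2) → ℤ × ℤ) ∧
        (∀ i k, i ≤ k → nsqZ ((Fin.cons a (Fin.cons b r) : Fin (m + 2) → ℤ × ℤ) k) ≤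
          nsqZ ((Fin.cons a (Fin.cons b r) : Fin (m + 2) → ℤ × ℤ) i))
        then ∏ i, gW ((Fin.cons a (Fin.cons b r) : Fin (m + 2) → ℤ × ℤ) i) ^ 14 else 0) ≤
      (A * gW j ^ 14) * (∏ i, gW (r i) ^ 16) *
        (if curve (σ 0) (σ 1) (c r) (e r) a b then gW b ^ 8 else 0) +
      (if EqR τ j r then ∏ i, gW (r i) ^ 14 else 0) * (if b = a then gW a ^ 16 else 0) := by
    intro r a b
    by_cases h1 : EqR σ j (Fin.cons a (Fin.cons b r) : Fin (m + 2) → ℤ × ℤ) ∧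
        (∀ i k, i ≤ k → nsqZ ((Fin.cons a (Fin.cons b r) : Fin (m + 2) → ℤ × ℤ) k) ≤
          nsqZ ((Fin.cons a (Fin.cons b r) : Fin (m + 2) → ℤ × ℤ) i))
    swap
    · rw [if_neg h1]; exact zero_le
    rw [if_pos h1]
    obtain ⟨hE, hs⟩ := h1
    have hab : nsqZ b ≤ nsqZ a := by simpa using hs 0 (Fin.succ 0) (Fin.zero_le _)
    have hbr : ∀ i, nsqZ (r i) ≤ nsqZ b := fun i => by
      have := hs (Fin.succ 0) i.succ.succ (Fin.succ_le_succ_iff.mpr (Fin.zero_le _))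
      simpa only [Fin.cons_succ, Fin.cons_zero] using this
    have hp := sorted_point hm σ hσ j a b r hE hab hbr
    have hE' := (EqR_cons σ j a b r).mp hE
    simp only [Fin.prod_univ_succ, Fin.cons_zero, Fin.cons_succ]
    by_cases h2 : curve (σ 0) (σ 1) (c r) (e r) a b
    · rw [if_pos h2]
      refine hp.trans (le_trans (le_of_eq ?_) le_self_add)
      rw [mul_comm (gW b ^ 8), ← mul_assoc]
    · have hdeg : a = b ∧ σ 0 = -σ 1 := by
        by_contra hcon
        exact h2 ⟨hE'.1, hE'.2, hcon⟩
      obtain ⟨rfl, h01⟩ := hdeg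
      have hEr : EqR τ j r := by
        obtain ⟨e1, e2⟩ := hE'
        rw [h01] at e1 e2
        constructor
        · rw [neg_smul, neg_add_cancel] at e1
          exact (sub_eq_zero.mp e1.symm).symm
        · simp only [hτ]
          linarith
      rw [if_pos hEr, if_pos rfl]
      refine le_trans ?_ le_add_self
      calc gW a ^ 14 * (gW a ^ 14 * ∏ i, gW (r i) ^ 14)
          = (∏ i, gW (r i) ^ 14) * gW a ^ 28 := by ring
        _ ≤ (∏ i, gW (r i) ^ 14) * gW a ^ 16 :=
          mul_le_mul' le_rfl (pow_le_pow_right_of_le_one' (gW_le_one a) (by norm_num))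
  calc _ ≤ ∑' (r : Fin m → ℤ × ℤ) (a : ℤ × ℤ) (b : ℤ × ℤ),
        ((A * gW j ^ 14) * (∏ i, gW (r i) ^ 16) *
        (if curve (σ 0) (σ 1) (c r) (e r) a b then gW b ^ 8 else 0) +
      (if EqR τ j r then ∏ i, gW (r i) ^ 14 else 0) * (if b = a then gW a ^ 16 else 0)) :=
        ENNReal.tsum_le_tsum fun r => ENNReal.tsum_le_tsum fun a =>
          ENNReal.tsum_le_tsum fun b => hpt r a b
    _ = ∑' (r : Fin m → ℤ × ℤ), (A * gW j ^ 14) * (∏ i, gW (r i) ^ 16) *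
          (∑' a, ∑' b, (if curve (σ 0) (σ 1) (c r) (e r) a b then gW b ^ 8 else 0)) +
        ∑' (r : Fin m → ℤ × ℤ), (if EqR τ j r then ∏ i, gW (r i) ^ 14 else 0) * G := by
        simp only [ENNReal.tsum_add, ENNReal.tsum_mul_left, tsum_ite_eq, hG]
    _ ≤ ∑' (r : Fin m → ℤ × ℤ), (A * gW j ^ 14) * (∏ i, gW (r i) ^ 16) * (2 * H) +
        (K * gW j ^ 14) * G := by
        refine add_le_add (ENNReal.tsum_le_tsum fun r => ?_) ?_
        · gcongr
          exact curve_sum _ _ (hσ _) (hσ _) _ _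
        · rw [ENNReal.tsum_mul_right]
          gcongr
          exact hKb τ (fun i => hσ _) j
    _ = (A * ((2 * H) * G ^ m) + G * K) * gW j ^ 14 := by
        rw [ENNReal.tsum_mul_right, ENNReal.tsum_mul_left, tsum_pi (fun p => gW p ^ 16)]
        ring

lemma Bd_step {m : ℕ} (hm : m ≤ 3) (hB : Bd m) : Bd (m + 2) := by
  obtain ⟨K, hK, hKb⟩ := sorted_sum hm hB
  refine ⟨(Fintype.card (Equiv.Perm (Fin (m + 2))) : ℝ≥0∞) * K,
    ENNReal.mul_ne_top (by simp) hK, fun σ hσ j => ?_⟩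
  have hpt : ∀ p : Fin (m + 2) → ℤ × ℤ, (if EqR σ j p then ∏ i, gW (p i) ^ 14 else 0) ≤
      ∑ τ : Equiv.Perm (Fin (m + 2)), (if EqR (σ ∘ τ) j (p ∘ τ) ∧
        (∀ i k, i ≤ k → nsqZ ((p ∘ τ) k) ≤ nsqZ ((p ∘ τ) i))
        then ∏ i, gW ((p ∘ τ) i) ^ 14 else 0) := by
    intro p
    split_ifs with hE
    · set τ := Tuple.sort (fun i => -nsqZ (p i)) with hτ
      refine le_trans (le_of_eq ?_) (Finset.single_le_sum (fun _ _ => zero_le)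
        (Finset.mem_univ τ))
      rw [if_pos]
      · exact (Equiv.prod_comp τ (fun i => gW (p i) ^ 14)).symm
      · refine ⟨⟨?_, ?_⟩, ?_⟩
        · rw [← hE.1]; exact Equiv.sum_comp τ (fun i => σ i • p i)
        · rw [← hE.2]; exact Equiv.sum_comp τ (fun i => σ i * nsqZ (p i))
        · intro i k hik
          have := Tuple.monotone_sort (fun i => -nsqZ (p i)) hik
          simpa using this
    · exact zero_le
  refine (ENNReal.tsum_le_tsum hpt).trans ?_
  rw [Summable.tsum_finsetSum (fun _ _ => ENNReal.summable)]
  rw [mul_assoc, ← nsmul_eq_mul, Fintype.card]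
  refine Finset.sum_le_card_nsmul _ _ _ fun τ _ => ?_
  refine le_trans (le_of_eq ?_) (hKb (σ ∘ τ) (fun i => hσ _) j)
  exact (Equiv.arrowCongr τ.symm (Equiv.refl (ℤ × ℤ))).tsum_eq
    (fun q => if EqR (σ ∘ τ) j q ∧
        (∀ i k, i ≤ k → nsqZ (q k) ≤ nsqZ (q i)) then ∏ i, gW (q i) ^ 14 else 0)

lemma Bd_five : Bd 5 := Bd_step (by norm_num) (Bd_step (by norm_num) Bd_one)

def toFun (v : Quint) : Fin 5 → ℤ × ℤ := ![v.1, v.2.1, v.2.2.1, v.2.2.2.1, v.2.2.2.2]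

lemma toFun_inj : Function.Injective toFun := by
  rintro ⟨a, b, c, d, e⟩ ⟨a', b', c', d', e'⟩ h
  have h0 := congrFun h 0
  have h1 := congrFun h 1
  have h2 := congrFun h 2
  have h3 := congrFun h 3
  have h4 := congrFun h 4
  simp [toFun] at h0 h1 h2 h3 h4
  simp [h0, h1, h2, h3, h4]

end Helpers

/-- The weighted counting bound: uniformly in `j ∈ ℤ²`, the sum over the resonant set `𝓡(j)` of
`∏_{k=1}^5 (1+|p_k|²)⁻¹` is at most `C (1+|j|²)⁻¹`.  (Stated for arbitrary finite subsets of
`𝓡(j)`, which is equivalent since all terms are nonnegative.) -/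
theorem stmt_3 :
    ∃ C : ℝ, 0 < C ∧ ∀ j : ℤ × ℤ, ∀ s : Finset Quint,
      (∀ v ∈ s, isRes j v) →
      ∑ v ∈ s,
          ((1 + (nsqZ v.1 : ℝ)) * (1 + (nsqZ v.2.1 : ℝ)) * (1 + (nsqZ v.2.2.1 : ℝ)) *
            (1 + (nsqZ v.2.2.2.1 : ℝ)) * (1 + (nsqZ v.2.2.2.2 : ℝ)))⁻¹
        ≤ C / (1 + (nsqZ j : ℝ)) := by
  classical
  obtain ⟨K, hK, hKb⟩ := Bd_five
  refine ⟨K.toReal + 1, by positivity, fun j s hs => ?_⟩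
  have hb := hKb ![1, -1, 1, -1, 1] (by intro i; fin_cases i <;> simp) j
  have hj : (0 : ℝ) ≤ nsqZ j := by exact_mod_cast nsqZ_nonneg j
  have hn : ∀ p, (0 : ℝ) ≤ nsqZ p := fun p => by exact_mod_cast nsqZ_nonneg p
  have key : ENNReal.ofReal (∑ v ∈ s,
      ((1 + (nsqZ v.1 : ℝ)) * (1 + (nsqZ v.2.1 : ℝ)) * (1 + (nsqZ v.2.2.1 : ℝ)) *
            (1 + (nsqZ v.2.2.2.1 : ℝ)) * (1 + (nsqZ v.2.2.2.2 : ℝ)))⁻¹) ≤ K * gW j ^ 14 := by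
    refine le_trans ?_ hb
    refine le_trans ?_ (ENNReal.sum_le_tsum (s.map ⟨toFun, toFun_inj⟩))
    rw [Finset.sum_map, ENNReal.ofReal_sum_of_nonneg]
    · refine Finset.sum_le_sum fun v hv => ?_
      obtain ⟨h1, h2⟩ := hs v hv
      rw [if_pos]
      · apply le_of_eq
        simp only [Fin.prod_univ_five, gW_pow]
        have p1 := hn v.1
        have p2 := hn v.2.1
        have p3 := hn v.2.2.1
        have p4 := hn v.2.2.2.1
        have p5 := hn v.2.2.2.2
        rw [mul_inv, mul_inv, mul_inv, mul_inv, ENNReal.ofReal_mul (by positivity),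
          ENNReal.ofReal_mul (by positivity), ENNReal.ofReal_mul (by positivity),
          ENNReal.ofReal_mul (by positivity)]
        rfl
      · constructor
        · rw [← h1]
          simp [Fin.sum_univ_five, toFun]
          abel
        · rw [← h2]
          simp [Fin.sum_univ_five, toFun]
          ring
    · intro v hv
      have p1 := hn v.1
      have p2 := hn v.2.1
      have p3 := hn v.2.2.1
      have p4 := hn v.2.2.2.1
      have p5 := hn v.2.2.2.2
      positivity
  rw [gW_pow, ← ENNReal.ofReal_toReal hK, ← ENNReal.ofReal_mul ENNReal.toReal_nonneg,
    ENNReal.ofReal_le_ofReal_iff (by positivity)] at key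
  refine key.trans ?_
  rw [← div_eq_mul_inv]
  gcongr
  linarith
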